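/- Let y' be an Sp-vexillary involution and let y = y' × 1^Sp_{2r} or y = 1^Sp_{2r} × y' for some r ≥ 0. Write Ess(D^Sp(y)) = {(i_1,j_1) ⊏ ⋯ ⊏ (i_s,j_s)} (a chain under the southwest-to-northeast order), and set k_p = j_p − rank y_{[i_p][j_p]} for p ∈ [s] and k_0 = 0. Then the shape sh^Sp(y) has exactly k_s nonzero parts, and for every k with k_{p−1} < k ≤ k_p for some p ∈ [s], sh^Sp(y)_k = i_p − j_p + k_p − k. -/

import Mathlib

open Classical

namespace UGS

/-- `w ∈ S_n`: a permutation of `ℕ` fixing everything outside `[1, n]`. -/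
def IsPermOn (n : ℕ) (w : Equiv.Perm ℕ) : Prop :=
  ∀ i : ℕ, i ∉ Finset.Icc 1 n → w i = i

/-- The Rothe diagram `D(w) = {(i,j) ∈ [n]×[n] : j < w(i), i < w⁻¹(j)}`. -/
def Rothe (n : ℕ) (w : Equiv.Perm ℕ) : Set (ℕ × ℕ) :=
  {p | p.1 ∈ Finset.Icc 1 n ∧ p.2 ∈ Finset.Icc 1 n ∧ p.2 < w p.1 ∧ p.1 < w.symm p.2}

/-- The essential set `Ess(D) = {(i,j) ∈ D : (i,j+1) ∉ D, (i+1,j) ∉ D}`. -/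
def Ess (D : Set (ℕ × ℕ)) : Set (ℕ × ℕ) :=
  {p | p ∈ D ∧ (p.1, p.2 + 1) ∉ D ∧ (p.1 + 1, p.2) ∉ D}

/-- Southwest-to-northeast order: `(i,j) ⊑ (i',j')` iff `i ≥ i'` and `j ≤ j'`. -/
def Swne (p q : ℕ × ℕ) : Prop := q.1 ≤ p.1 ∧ p.2 ≤ q.2

/-- Strict version of the southwest-to-northeast order. -/
def SwneLt (p q : ℕ × ℕ) : Prop := Swne p q ∧ p ≠ q

/-- A set of cells is a chain under the southwest-to-northeast order. -/
def IsSwneChain (S : Set (ℕ × ℕ)) : Prop :=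
  ∀ p ∈ S, ∀ q ∈ S, Swne p q ∨ Swne q p

/-- `w` is vexillary: it avoids the pattern 2143 on `[n]`. -/
def Vexillary (n : ℕ) (w : Equiv.Perm ℕ) : Prop :=
  ¬ ∃ i j k l : ℕ, 1 ≤ i ∧ i < j ∧ j < k ∧ k < l ∧ l ≤ n ∧
      w j < w i ∧ w i < w l ∧ w l < w k

/-- `rank w_{[i][j]} = #{a ∈ [i] : w(a) ∈ [j]}`. -/
def rankUL (w : Equiv.Perm ℕ) (i j : ℕ) : ℕ :=
  ((Finset.Icc 1 i).filter fun a => w a ∈ Finset.Icc 1 j).card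

/-- The code `c_i(w) = #{j > i : w(j) < w(i)}`. -/
def code (n : ℕ) (w : Equiv.Perm ℕ) (i : ℕ) : ℕ :=
  ((Finset.Ioc i n).filter fun j => w j < w i).card

/-- The shape `sh(w)_k = #{i ∈ [n] : c_i(w) ≥ k}`. -/
def shape (n : ℕ) (w : Equiv.Perm ℕ) (k : ℕ) : ℕ :=
  ((Finset.Icc 1 n).filter fun i => k ≤ code n w i).card

/-- `D^O(y) = D(y) ∩ {(i,j) : i ≥ j}`. -/
def DO (n : ℕ) (y : Equiv.Perm ℕ) : Set (ℕ × ℕ) :=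
  Rothe n y ∩ {p | p.2 ≤ p.1}

/-- `D^Sp(y) = D(y) ∩ {(i,j) : i > j}`. -/
def DSp (n : ℕ) (y : Equiv.Perm ℕ) : Set (ℕ × ℕ) :=
  Rothe n y ∩ {p | p.2 < p.1}

/-- `c^O_i(y) = #{j ∈ [i] : y(i) > j, y(j) > i}`. -/
def codeO (y : Equiv.Perm ℕ) (i : ℕ) : ℕ :=
  ((Finset.Icc 1 i).filter fun j => j < y i ∧ i < y j).card

/-- `c^Sp_i(y) = #{j ∈ [i-1] : y(i) > j, y(j) > i}`. -/
def codeSp (y : Equiv.Perm ℕ) (i : ℕ) : ℕ :=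
  ((Finset.Ico 1 i).filter fun j => j < y i ∧ i < y j).card

/-- `sh^O(y)_k = #{i ∈ [n] : c^O_i(y) ≥ k}`. -/
def shapeO (n : ℕ) (y : Equiv.Perm ℕ) (k : ℕ) : ℕ :=
  ((Finset.Icc 1 n).filter fun i => k ≤ codeO y i).card

/-- `sh^Sp(y)_k = #{i ∈ [n] : c^Sp_i(y) ≥ k}`. -/
def shapeSp (n : ℕ) (y : Equiv.Perm ℕ) (k : ℕ) : ℕ :=
  ((Finset.Icc 1 n).filter fun i => k ≤ codeSp y i).card

/-- `y` is Sp-vexillary: vexillary and `Ess(D^Sp(y))` is a chain under `⊑`. -/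
def SpVexillary (n : ℕ) (y : Equiv.Perm ℕ) : Prop :=
  Vexillary n y ∧ IsSwneChain (Ess (DSp n y))

/-- `y` acts as `1^Sp_{2r} = (a+1,a+2)(a+3,a+4)⋯(a+2r-1,a+2r)` on the window
`[a+1, a+2r]`. -/
def IsFpfBaseOn (a r : ℕ) (y : Equiv.Perm ℕ) : Prop :=
  ∀ t, 1 ≤ t → t ≤ r → y (a + 2 * t - 1) = a + 2 * t ∧ y (a + 2 * t) = a + 2 * t - 1

def KK (y : Equiv.Perm ℕ) (i j : ℕ) : ℕ :=
  ((Finset.Icc 1 j).filter fun a => i < y a).card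

lemma y_zero {n : ℕ} {y : Equiv.Perm ℕ} (hy : IsPermOn n y) : y 0 = 0 := hy 0 (by simp)

lemma y_pos {n : ℕ} {y : Equiv.Perm ℕ} (hy : IsPermOn n y) {a : ℕ} (h : 1 ≤ a) : 1 ≤ y a := by
  by_contra hc
  have h0 : y a = 0 := by omega
  have := y.injective (h0.trans (y_zero hy).symm)
  omega

lemma y_le {n : ℕ} {y : Equiv.Perm ℕ} (hy : IsPermOn n y) {a : ℕ} (h : a ≤ n) : y a ≤ n := by
  by_contra hc
  have h0 : y (y a) = y a := hy _ (by simp; omega)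
  have := y.injective h0
  omega

lemma y_symm {y : Equiv.Perm ℕ} (hinv : Function.Involutive ⇑y) (a : ℕ) : y.symm a = y a := by
  rw [Equiv.symm_apply_eq]; exact (hinv a).symm

lemma mem_DSp {n : ℕ} {y : Equiv.Perm ℕ} (hy : IsPermOn n y) (hinv : Function.Involutive ⇑y)
    (i j : ℕ) : (i, j) ∈ DSp n y ↔ 1 ≤ j ∧ j < i ∧ j < y i ∧ i < y j := by
  simp only [DSp, Rothe, Set.mem_inter_iff, Set.mem_setOf_eq, Finset.mem_Icc, y_symm hinv]
  constructor
  · rintro ⟨⟨a, b, c, d⟩, f⟩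
    exact ⟨b.1, f, c, d⟩
  · rintro ⟨a, b, c, d⟩
    have hj : j ≤ n := by
      by_contra hc
      have := hy j (by simp; omega)
      omega
    have := y_le hy hj
    refine ⟨⟨⟨by omega, by omega⟩, ⟨a, hj⟩, c, d⟩, b⟩

lemma KK_eq {n : ℕ} {y : Equiv.Perm ℕ} (hy : IsPermOn n y) (hinv : Function.Involutive ⇑y)
    (i j : ℕ) : j - rankUL y i j = KK y i j := by
  have h1 : rankUL y i j = ((Finset.Icc 1 j).filter fun a => ¬ i < y a).card := by
    unfold rankUL
    apply Finset.card_bij (fun a _ => y a)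
    · intro a ha
      simp only [Finset.mem_filter, Finset.mem_Icc] at ha ⊢
      rw [hinv a]
      omega
    · intro a _ b _ h
      exact y.injective h
    · intro b hb
      simp only [Finset.mem_filter, Finset.mem_Icc] at hb
      refine ⟨y b, ?_, hinv b⟩
      simp only [Finset.mem_filter, Finset.mem_Icc]
      rw [hinv b]
      have := y_pos hy hb.1.1
      omega
  have h2 := Finset.card_filter_add_card_filter_not (s := Finset.Icc 1 j) (fun a => i < y a)
  rw [Nat.card_Icc] at h2
  unfold KK
  omega

lemma KK_mono {y : Equiv.Perm ℕ} {i j i' j' : ℕ} (hi : i' ≤ i) (hj : j ≤ j') :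
    KK y i j ≤ KK y i' j' := by
  apply Finset.card_le_card
  intro a ha
  simp only [Finset.mem_filter, Finset.mem_Icc] at ha ⊢
  omega

lemma exists_ess {n : ℕ} {y : Equiv.Perm ℕ} (hy : IsPermOn n y) (hinv : Function.Involutive ⇑y) :
    ∀ N i j : ℕ, 2 * n ≤ N + i + j → (i, j) ∈ DSp n y →
    ∃ f ∈ Ess (DSp n y), i ≤ f.1 ∧ KK y i j ≤ KK y f.1 f.2 ∧
      ∀ c, j < c → y c ≤ i → f.2 < c := by
  intro N
  induction N with
  | zero =>
    intro i j h hD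
    exfalso
    have h2 := (mem_DSp hy hinv i j).1 hD
    simp only [DSp, Rothe, Set.mem_inter_iff, Set.mem_setOf_eq, Finset.mem_Icc] at hD
    omega
  | succ N ih =>
    intro i j h hD
    by_cases hr : (i, j + 1) ∈ DSp n y
    · obtain ⟨f, hf, h1, h2, h3⟩ := ih i (j + 1) (by omega) hr
      refine ⟨f, hf, h1, le_trans (KK_mono le_rfl (by omega)) h2, ?_⟩
      intro c hc hyc
      apply h3 c _ hyc
      rcases Nat.lt_or_ge (j + 1) c with h' | h'
      · exact h'
      · have hcj : c = j + 1 := by omega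
        have := (mem_DSp hy hinv _ _).1 hr
        rw [← hcj] at this
        omega
    · by_cases hd : (i + 1, j) ∈ DSp n y
      · obtain ⟨f, hf, h1, h2, h3⟩ := ih (i + 1) j (by omega) hd
        refine ⟨f, hf, by omega, le_trans ?_ h2, fun c hc hyc => h3 c hc (by omega)⟩
        apply Finset.card_le_card
        intro a ha
        simp only [Finset.mem_filter, Finset.mem_Icc] at ha ⊢
        have := (mem_DSp hy hinv _ _).1 hd
        have hne : y a ≠ i + 1 := by
          intro he
          rw [← he, hinv a] at this
          omega
        omega
      · exact ⟨(i, j), ⟨hD, hr, hd⟩, le_rfl, le_rfl, fun c hc _ => hc⟩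

lemma exists_cell {y : Equiv.Perm ℕ} {x : ℕ} (h : 1 ≤ codeSp y x) :
    ∃ z, 1 ≤ z ∧ z < x ∧ z < y x ∧ x < y z ∧
      ((Finset.Ico 1 x).filter fun j => j < y x ∧ x < y j) ⊆
        (Finset.Icc 1 z).filter fun a => x < y a := by
  have hne : ((Finset.Ico 1 x).filter fun j => j < y x ∧ x < y j).Nonempty :=
    Finset.card_pos.1 h
  have hm := Finset.max'_mem _ hne
  set z := Finset.max' _ hne with hz
  have hm' := hm
  simp only [Finset.mem_filter, Finset.mem_Ico] at hm'
  refine ⟨z, by omega, by omega, by omega, by omega, ?_⟩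
  intro a ha
  have := Finset.le_max' _ a ha
  rw [← hz] at this
  simp only [Finset.mem_filter, Finset.mem_Ico, Finset.mem_Icc] at ha ⊢
  omega

lemma card_rank_ge (G : Finset ℕ) (k : ℕ) :
    (G.filter fun g => k ≤ (G.filter fun x => x < g).card).card = G.card - k := by
  induction G using Finset.induction_on_max with
  | empty => simp
  | insert a s ha ih =>
    have hna : a ∉ s := fun h => lt_irrefl _ (ha a h)
    have e1 : ((insert a s).filter fun x => x < a) = s := by
      ext x
      simp only [Finset.mem_filter, Finset.mem_insert]
      constructor
      · rintro ⟨h | h, h'⟩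
        · omega
        · exact h
      · intro h
        exact ⟨Or.inr h, ha x h⟩
    have e2 : ∀ g ∈ s, ((insert a s).filter fun x => x < g) = s.filter fun x => x < g := by
      intro g hg
      rw [Finset.filter_insert, if_neg]
      have := ha g hg
      omega
    have e3 : (s.filter fun g => k ≤ ((insert a s).filter fun x => x < g).card)
        = s.filter fun g => k ≤ (s.filter fun x => x < g).card := by
      apply Finset.filter_congr
      intro g hg
      rw [e2 g hg]
    rw [Finset.filter_insert, e1, e3, Finset.card_insert_of_notMem hna]
    split_ifs with h
    · rw [Finset.card_insert_of_notMem (by simp [hna]), ih]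
      omega
    · rw [ih]; omega

theorem core (n lo hi : ℕ) (y : Equiv.Perm ℕ) (hy : IsPermOn n y)
    (hinv : Function.Involutive ⇑y)
    (H1 : ∀ x, x ≤ lo → y x ≤ lo)
    (H2 : ∀ i j, 1 ≤ j → j < i → j < y i → i < y j → lo < j ∧ i ≤ hi)
    (H3 : ∀ x, x ≤ hi → y x ≤ hi)
    (V : ∀ a b c d, lo < a → a < b → b < c → c < d → d ≤ hi →
      y b < y a → y a < y d → y d < y c → False)
    (s : ℕ) (e : ℕ → ℕ × ℕ)
    (hchain : ∀ p q, 1 ≤ p → p < q → q ≤ s → SwneLt (e p) (e q))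
    (hrange : Ess (DSp n y) = {x | ∃ p, 1 ≤ p ∧ p ≤ s ∧ e p = x})
    (k : ℕ → ℕ) (hk0 : k 0 = 0)
    (hk : ∀ p, 1 ≤ p → p ≤ s → k p = (e p).2 - rankUL y (e p).1 (e p).2) :
    (∀ kk, 1 ≤ kk → (0 < shapeSp n y kk ↔ kk ≤ k s)) ∧
    (∀ p kk, 1 ≤ p → p ≤ s → k (p - 1) < kk → kk ≤ k p →
      shapeSp n y kk = (e p).1 - (e p).2 + k p - kk) := by
  have hk' : ∀ p, 1 ≤ p → p ≤ s → k p = KK y (e p).1 (e p).2 := by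
    intro p h1 h2
    rw [hk p h1 h2, KK_eq hy hinv]
  have hD : ∀ p, 1 ≤ p → p ≤ s → 1 ≤ (e p).2 ∧ (e p).2 < (e p).1 ∧ (e p).2 < y (e p).1 ∧
      (e p).1 < y (e p).2 := by
    intro p h1 h2
    have : e p ∈ Ess (DSp n y) := by rw [hrange]; exact ⟨p, h1, h2, rfl⟩
    exact (mem_DSp hy hinv _ _).1 this.1
  have hle : ∀ p q, 1 ≤ p → p ≤ q → q ≤ s → (e q).1 ≤ (e p).1 ∧ (e p).2 ≤ (e q).2 := by
    intro p q h1 h2 h3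
    rcases Nat.lt_or_ge p q with h | h
    · exact (hchain p q h1 h h3).1
    · have : p = q := by omega
      subst this; exact ⟨le_rfl, le_rfl⟩
  have kmono : ∀ p q, 1 ≤ p → p ≤ q → q ≤ s → k p ≤ k q := by
    intro p q h1 h2 h3
    rw [hk' p h1 (by omega), hk' q (by omega) h3]
    exact KK_mono (hle p q h1 h2 h3).1 (hle p q h1 h2 h3).2
  -- from a cell to an index
  have hcell : ∀ i j, 1 ≤ j → j < i → j < y i → i < y j → ∃ q, 1 ≤ q ∧ q ≤ s ∧
      i ≤ (e q).1 ∧ KK y i j ≤ k q ∧ ∀ c, j < c → y c ≤ i → (e q).2 < c := by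
    intro i j h1 h2 h3 h4
    obtain ⟨f, hf, a1, a2, a3⟩ := exists_ess hy hinv (2 * n) i j (by omega)
      ((mem_DSp hy hinv i j).2 ⟨h1, h2, h3, h4⟩)
    rw [hrange] at hf
    obtain ⟨q, q1, q2, rfl⟩ := hf
    exact ⟨q, q1, q2, a1, by rw [hk' q q1 q2]; exact a2, a3⟩
  have hcode : ∀ x, 1 ≤ codeSp y x → ∃ q, 1 ≤ q ∧ q ≤ s ∧
      x ≤ (e q).1 ∧ codeSp y x ≤ k q ∧ ∀ c, y x ≤ c → y c ≤ x → (e q).2 < c := by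
    intro x hx
    obtain ⟨z, z1, z2, z3, z4, z5⟩ := exists_cell hx
    obtain ⟨q, q1, q2, q3, q4, q5⟩ := hcell x z z1 z2 z3 z4
    exact ⟨q, q1, q2, q3, le_trans (Finset.card_le_card z5) q4,
      fun c hc hc' => q5 c (by omega) hc'⟩
  constructor
  · intro kk hkk
    constructor
    · intro h
      obtain ⟨x, hx⟩ := Finset.card_pos.1 h
      simp only [Finset.mem_filter, Finset.mem_Icc] at hx
      obtain ⟨q, q1, q2, q3, q4, q5⟩ := hcode x (by omega)
      have := kmono q s q1 q2 le_rfl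
      omega
    · intro h
      have hs : 1 ≤ s := by
        by_contra hc
        have : s = 0 := by omega
        rw [this, hk0] at h
        omega
      obtain ⟨d1, d2, d3, d4⟩ := hD s hs le_rfl
      apply Finset.card_pos.2
      refine ⟨(e s).1, ?_⟩
      have hin : (e s).1 ≤ n := by
        by_contra hc
        have h1 := hy (e s).1 (by simp; omega)
        by_cases h2 : (e s).2 ≤ n
        · have := y_le hy h2; omega
        · have := hy (e s).2 (by simp; omega)
          omega
      simp only [Finset.mem_filter, Finset.mem_Icc]
      refine ⟨⟨by omega, hin⟩, le_trans h ?_⟩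
      rw [hk' s hs le_rfl]
      apply Finset.card_le_card
      intro a ha
      simp only [Finset.mem_filter, Finset.mem_Icc, Finset.mem_Ico] at ha ⊢
      omega
  · intro p kk hp1 hps hlt hkp
    obtain ⟨d1, d2, d3, d4⟩ := hD p hp1 hps
    have hkp' := hk' p hp1 hps
    have hkprev : ∀ q, 1 ≤ q → q ≤ s → ((e p).1 < (e q).1 ∨ (e q).2 < (e p).2) → k q < kk := by
      intro q q1 q2 h
      have hqp : q < p := by
        by_contra hc
        have := hle p q hp1 (by omega) q2
        omega
      have := kmono q (p - 1) q1 (by omega) (by omega)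
      omega
    obtain ⟨hlo, hhi⟩ := H2 _ _ d1 d2 d3 d4
    generalize (e p).1 = i at *
    generalize (e p).2 = j at *
    have hyi := H3 i hhi
    have hyj := H3 j (by omega)
    -- facts on B
    have B1 : ∀ b, lo < b → b ≤ j → y b ≤ j → y b = b := by
      intro b hb hbj hyb
      by_contra hne
      have hb2 : b ≠ j := by rintro rfl; omega
      have hb3 : y b ≠ j := by
        intro h
        have := hinv b
        rw [h] at this
        omega
      have hlb : lo < y b := by
        by_contra hc
        have := H1 (y b) (by omega)
        rw [hinv b] at this
        omega
      have hjj := hinv j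
      rcases Nat.lt_or_ge b (y b) with h | h
      · apply V b (y b) j (y j) <;> first | assumption | (try rw [hinv b]) <;> omega
      · apply V (y b) b j (y j) <;> first | assumption | (try rw [hinv b]) <;> omega
    have B2 : ∀ b c, lo < c → c < b → b ≤ j → y b = b → j < y c → y c ≤ i → False := by
      intro b c h1 h2 h3 h4 h5 h6
      have hb2 : b ≠ j := by rintro rfl; omega
      have hci : y c ≠ i := by
        intro h
        have := hinv c
        rw [h] at this
        omega
      have hii := hinv i
      apply V c b j (y i) <;> first | assumption | omega
    have B3 : ∀ b, 1 ≤ b → b ≤ j → y b ≤ j → codeSp y b < kk := by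
      intro b hb1 hbj hyb
      by_contra hc
      obtain ⟨z, z1, z2, z3, z4, z5⟩ := exists_cell (y := y) (x := b) (by omega)
      have hz := H2 b z z1 z2 z3 z4
      have hfix := B1 b (by omega) hbj hyb
      have key : ∀ x, 1 ≤ x → x < b → b < y x → i < y x := by
        intro x x1 x2 x3
        by_contra hxi
        have hx := H2 b x x1 x2 (by omega) x3
        by_cases hyx : y x ≤ j
        · have := B1 x hx.1 (by omega) hyx
          omega
        · exact B2 b x hx.1 x2 hbj hfix (by omega) (by omega)
      obtain ⟨q, q1, q2, q3, q4, q5⟩ := hcell i z z1 (by omega) (by omega) (key z z1 z2 z4)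
      have h1 := q5 b z2 (by omega)
      have h2 := hkprev q q1 q2 (Or.inr (by omega))
      have h3 : codeSp y b ≤ KK y i z := by
        apply Finset.card_le_card
        intro a ha
        have ha' := z5 ha
        simp only [Finset.mem_filter, Finset.mem_Icc] at ha' ⊢
        have := key a (by omega) (by omega) ha'.2
        omega
      omega
    have C1 : ∀ x, j < x → y x ≤ j → codeSp y x < kk := by
      intro x hx hyx
      by_contra hc
      obtain ⟨q, q1, q2, q3, q4, q5⟩ := hcode x (by omega)
      have h1 := q5 (y x) le_rfl (by rw [hinv x])
      have := hkprev q q1 q2 (Or.inr (by omega))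
      omega
    have R1 : ∀ x, i < x → codeSp y x < kk := by
      intro x hx
      by_contra hc
      obtain ⟨q, q1, q2, q3, q4, q5⟩ := hcode x (by omega)
      have := hkprev q q1 q2 (Or.inl (by omega))
      omega
    have E1 : ∀ x, j < x → x ≤ i → j < y x → kk ≤ codeSp y x := by
      intro x x1 x2 x3
      refine le_trans hkp ?_
      rw [hkp']
      apply Finset.card_le_card
      intro a ha
      simp only [Finset.mem_filter, Finset.mem_Icc, Finset.mem_Ico] at ha ⊢
      omega
    set G := (Finset.Icc 1 j).filter fun x => j < y x with hG
    have G1 : ∀ g ∈ G, codeSp y g = (G.filter fun x => x < g).card := by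
      intro g hg
      simp only [hG, Finset.mem_filter, Finset.mem_Icc] at hg
      unfold codeSp
      congr 1
      ext x
      simp only [hG, Finset.mem_filter, Finset.mem_Icc, Finset.mem_Ico]
      constructor
      · rintro ⟨⟨x1, x2⟩, x3, x4⟩
        refine ⟨⟨⟨x1, by omega⟩, ?_⟩, x2⟩
        by_contra hc
        have := H2 g x x1 x2 x3 x4
        have := B1 x this.1 (by omega) (by omega)
        omega
      · rintro ⟨⟨⟨x1, x2⟩, x3⟩, x4⟩
        exact ⟨⟨x1, x4⟩, by omega, by omega⟩
    set E := (Finset.Ioc j i).filter fun x => j < y x with hE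
    have hin : i ≤ n := by
      have := ((mem_DSp hy hinv i j).2 ⟨d1, d2, d3, d4⟩).1.1
      simp only [Finset.mem_Icc] at this
      omega
    have hS : ((Finset.Icc 1 n).filter fun x => kk ≤ codeSp y x)
        = (G.filter fun g => kk ≤ (G.filter fun x => x < g).card) ∪ E := by
      ext x
      rw [Finset.mem_union, Finset.mem_filter, Finset.mem_filter]
      constructor
      · rintro ⟨hx, hc⟩
        rw [Finset.mem_Icc] at hx
        by_cases hxj : x ≤ j
        · left
          have hxG : x ∈ G := by
            simp only [hG, Finset.mem_filter, Finset.mem_Icc]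
            refine ⟨⟨hx.1, hxj⟩, ?_⟩
            by_contra hyx
            have := B3 x hx.1 hxj (by omega)
            omega
          exact ⟨hxG, by rw [← G1 x hxG]; exact hc⟩
        · right
          simp only [hE, Finset.mem_filter, Finset.mem_Ioc]
          refine ⟨⟨by omega, ?_⟩, ?_⟩
          · by_contra h
            have := R1 x (by omega)
            omega
          · by_contra h
            have := C1 x (by omega) (by omega)
            omega
      · rintro (⟨hx, hc⟩ | hx)
        · rw [← G1 x hx] at hc
          simp only [hG, Finset.mem_filter, Finset.mem_Icc] at hx
          exact ⟨by rw [Finset.mem_Icc]; omega, hc⟩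
        · simp only [hE, Finset.mem_filter, Finset.mem_Ioc] at hx
          exact ⟨by rw [Finset.mem_Icc]; omega, E1 x (by omega) (by omega) hx.2⟩
    have hdisj : Disjoint (G.filter fun g => kk ≤ (G.filter fun x => x < g).card) E := by
      rw [Finset.disjoint_left]
      intro x hx hx'
      have hx := (Finset.mem_filter.1 hx).1
      simp only [hG, Finset.mem_filter, Finset.mem_Icc] at hx
      simp only [hE, Finset.mem_filter, Finset.mem_Ioc] at hx'
      omega
    have hcE := Finset.card_filter_add_card_filter_not (s := Finset.Ioc j i) (fun x => j < y x)
    rw [Nat.card_Ioc] at hcE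
    have hcG := Finset.card_filter_add_card_filter_not (s := G) (fun x => i < y x)
    have hGK : (G.filter fun x => i < y x).card = KK y i j := by
      unfold KK
      congr 1
      ext x
      simp only [hG, Finset.mem_filter, Finset.mem_Icc]
      omega
    have hC : (G.filter fun x => ¬ i < y x).card
        = ((Finset.Ioc j i).filter fun x => ¬ j < y x).card := by
      apply Finset.card_bij (fun a _ => y a)
      · intro a ha
        simp only [hG, Finset.mem_filter, Finset.mem_Icc, Finset.mem_Ioc] at ha ⊢
        rw [hinv a]
        omega
      · intro a _ b _ h
        exact y.injective h
      · intro b hb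
        simp only [Finset.mem_filter, Finset.mem_Ioc] at hb
        refine ⟨y b, ?_, hinv b⟩
        simp only [hG, Finset.mem_filter, Finset.mem_Icc]
        rw [hinv b]
        have := y_pos hy (a := b) (by omega)
        omega
    unfold shapeSp
    rw [hS, Finset.card_union_of_disjoint hdisj, card_rank_ge]
    rw [hGK, hC] at hcG
    rw [← hE] at hcE
    omega

theorem fpf_shape_of_spvexillary (m r n : ℕ) (hn : n = m + 2 * r)
    (y' y : Equiv.Perm ℕ)
    (hy' : IsPermOn m y') (hinv' : Function.Involutive ⇑y')
    (hspvex : SpVexillary m y')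
    (hy : IsPermOn n y) (hinv : Function.Involutive ⇑y)
    -- `y = y' × 1^Sp_{2r}` or `y = 1^Sp_{2r} × y'`
    (hprod :
      ((∀ i, i ≤ m → y i = y' i) ∧ IsFpfBaseOn m r y) ∨
      (IsFpfBaseOn 0 r y ∧ ∀ i, 1 ≤ i → i ≤ m → y (2 * r + i) = y' i + 2 * r))
    (s : ℕ) (e : ℕ → ℕ × ℕ)
    (hchain : ∀ p q, 1 ≤ p → p < q → q ≤ s → SwneLt (e p) (e q))
    (hrange : Ess (DSp n y) = {x | ∃ p, 1 ≤ p ∧ p ≤ s ∧ e p = x})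
    (k : ℕ → ℕ) (hk0 : k 0 = 0)
    (hk : ∀ p, 1 ≤ p → p ≤ s → k p = (e p).2 - rankUL y (e p).1 (e p).2) :
    (∀ kk, 1 ≤ kk → (0 < shapeSp n y kk ↔ kk ≤ k s)) ∧
    (∀ p kk, 1 ≤ p → p ≤ s → k (p - 1) < kk → kk ≤ k p →
      shapeSp n y kk = (e p).1 - (e p).2 + k p - kk) := by
  rcases hprod with ⟨hA, hB⟩ | ⟨hB, hA⟩
  · have Hb : ∀ x, m < x → y x ≤ x + 1 := by
      intro x hx
      by_cases hxn : x ≤ n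
      · rcases Nat.even_or_odd' (x - m) with ⟨t, ht | ht⟩
        · have := (hB t (by omega) (by omega)).2
          rw [show m + 2 * t = x by omega] at this
          omega
        · have := (hB (t + 1) (by omega) (by omega)).1
          rw [show m + 2 * (t + 1) - 1 = x by omega] at this
          omega
      · rw [hy x (by simp; omega)]; omega
    have H3 : ∀ x, x ≤ m → y x ≤ m := fun x hx => by rw [hA x hx]; exact y_le hy' hx
    refine core n 0 m y hy hinv ?_ ?_ H3 ?_ s e hchain hrange k hk0 hk
    · intro x hx
      have : x = 0 := by omega
      rw [this, y_zero hy]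
    · intro i j h1 h2 h3 h4
      refine ⟨h1, ?_⟩
      by_contra hc
      by_cases hj : j ≤ m
      · have := H3 j hj; omega
      · have := Hb j (by omega); omega
    · intro a b c d h1 h2 h3 h4 h5 h6 h7 h8
      rw [hA b (by omega), hA a (by omega)] at h6
      rw [hA a (by omega), hA d (by omega)] at h7
      rw [hA d (by omega), hA c (by omega)] at h8
      exact hspvex.1 ⟨a, b, c, d, h1, h2, h3, h4, h5, h6, h7, h8⟩
  · have Hb : ∀ x, x ≤ 2 * r → y x ≤ x + 1 ∧ y x ≤ 2 * r := by
      intro x hx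
      by_cases hx0 : x = 0
      · rw [hx0, y_zero hy]; omega
      · rcases Nat.even_or_odd' x with ⟨t, ht | ht⟩
        · have := (hB t (by omega) (by omega)).2
          rw [show 0 + 2 * t = x by omega] at this
          omega
        · have := (hB (t + 1) (by omega) (by omega)).1
          rw [show 0 + 2 * (t + 1) - 1 = x by omega] at this
          omega
    refine core n (2 * r) n y hy hinv (fun x hx => (Hb x hx).2) ?_ (fun x hx => y_le hy hx) ?_
      s e hchain hrange k hk0 hk
    · intro i j h1 h2 h3 h4
      constructor
      · by_contra hc
        have := Hb j (by omega)
        omega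
      · have := ((mem_DSp hy hinv i j).2 ⟨h1, h2, h3, h4⟩).1.1
        simp only [Finset.mem_Icc] at this
        omega
    · intro a b c d h1 h2 h3 h4 h5 h6 h7 h8
      have hA' : ∀ x, 2 * r < x → x ≤ n → y x = y' (x - 2 * r) + 2 * r := by
        intro x hx hx'
        have := hA (x - 2 * r) (by omega) (by omega)
        rwa [show 2 * r + (x - 2 * r) = x by omega] at this
      have ea := hA' a (by omega) (by omega)
      have eb := hA' b (by omega) (by omega)
      have ec := hA' c (by omega) (by omega)
      have ed := hA' d (by omega) (by omega)
      exact hspvex.1 ⟨a - 2 * r, b - 2 * r, c - 2 * r, d - 2 * r, by omega, by omega, by omega,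
        by omega, by omega, by omega, by omega, by omega⟩
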